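/- Let n ≥ 2 be an integer. Then there is no 3-(v, 4n−1, 1) block design with v = (2n−1)(4n−1) + 1. That is, there is no set D of (4n−1)-element subsets of a v-element set V such that every 3-element subset of V is contained in exactly 1 member of D. -/

import Mathlib

/-- In a Steiner system `S(3, k, v)` with a block missing some point, `(k - 1) (k - 2) ≤ v - 2`:
fixing `p` in a block `B` and `x` outside `B`, the blocks joining `p` and `x` to the other points
of `B` meet pairwise only in `{p, x}`. -/
theorem steiner_three_card_bound {V : Type*} [Fintype V] [DecidableEq V] {k : ℕ}
    {D : Finset (Finset V)} (hblocks : ∀ B ∈ D, B.card = k)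
    (hdesign : ∀ T : Finset V, T.card = 3 → (D.filter (fun B => T ⊆ B)).card = 1)
    {B : Finset V} (hB : B ∈ D) {p x : V} (hp : p ∈ B) (hx : x ∉ B) :
    (k - 1) * (k - 2) ≤ Fintype.card V - 2 := by
  have huniq : ∀ a b c : V, a ≠ b → a ≠ c → b ≠ c → ∀ C ∈ D, ∀ C' ∈ D,
      a ∈ C → b ∈ C → c ∈ C → a ∈ C' → b ∈ C' → c ∈ C' → C = C' := by
    intro a b c hab hac hbc C hC C' hC' h1 h2 h3 h4 h5 h6
    refine Finset.card_le_one.1 (hdesign {a, b, c}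
      (Finset.card_eq_three.2 ⟨a, b, c, hab, hac, hbc, rfl⟩)).le C ?_ C' ?_ <;>
    simp [Finset.insert_subset_iff, *]
  have hpx : p ≠ x := fun h => hx (h ▸ hp)
  have hex : ∀ q : V, ∃ C : Finset V, q ∈ B.erase p → C ∈ D ∧ p ∈ C ∧ x ∈ C ∧ q ∈ C := by
    intro q
    by_cases hq : q ∈ B.erase p
    · obtain ⟨hqp, hqB⟩ := Finset.mem_erase.1 hq
      have hxq : x ≠ q := fun h => hx (h ▸ hqB)
      obtain ⟨C, hC⟩ := Finset.card_pos.1 ((hdesign {p, x, q}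
        (Finset.card_eq_three.2 ⟨p, x, q, hpx, hqp.symm, hxq, rfl⟩)).symm ▸ Nat.one_pos)
      simp only [Finset.mem_filter, Finset.insert_subset_iff, Finset.singleton_subset_iff] at hC
      exact ⟨C, fun _ => hC⟩
    · exact ⟨∅, fun h => absurd h hq⟩
  choose f hf using hex
  have hdisj : (B.erase p : Set V).PairwiseDisjoint fun q => f q \ {p, x} := by
    intro q hq q' hq' hne
    obtain ⟨hD, hpC, hxC, hqC⟩ := hf q hq
    obtain ⟨hD', hpC', hxC', hqC'⟩ := hf q' hq'
    obtain ⟨hqp, hqB⟩ := Finset.mem_erase.1 hq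
    obtain ⟨hqp', hqB'⟩ := Finset.mem_erase.1 hq'
    refine Finset.disjoint_left.2 fun y hy hy' => hx ?_
    simp only [Finset.mem_sdiff, Finset.mem_insert, Finset.mem_singleton, not_or] at hy hy'
    have heq : f q = f q' := huniq p x y hpx (Ne.symm hy.2.1) (Ne.symm hy.2.2) _ hD _ hD'
      hpC hxC hy.1 hpC' hxC' hy'.1
    exact huniq p q q' hqp.symm hqp'.symm hne _ hD _ hB hpC hqC (heq ▸ hqC') hp hqB hqB' ▸ hxC
  have hpair : ({p, x} : Finset V).card = 2 := Finset.card_pair hpx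
  calc (k - 1) * (k - 2) = ∑ q ∈ B.erase p, (f q \ {p, x}).card := by
        rw [Finset.sum_const_nat (m := k - 2), Finset.card_erase_of_mem hp, hblocks B hB]
        intro q hq
        obtain ⟨hD, hpC, hxC, -⟩ := hf q hq
        rw [Finset.card_sdiff_of_subset (by simp [Finset.insert_subset_iff, hpC, hxC]), hpair,
          hblocks _ hD]
    _ = ((B.erase p).biUnion fun q => f q \ {p, x}).card := (Finset.card_biUnion hdisj).symm
    _ ≤ (Finset.univ \ {p, x} : Finset V).card := by
        refine Finset.card_le_card (Finset.biUnion_subset.2 fun q _ => ?_)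
        exact Finset.sdiff_subset_sdiff (Finset.subset_univ _) subset_rfl
    _ = Fintype.card V - 2 := by
        rw [Finset.card_sdiff_of_subset (Finset.subset_univ _), hpair, Finset.card_univ]

/-- For `n ≥ 2`, there is no `3-(v, 4n−1, 1)` block design (Steiner system) with
`v = (2n−1)(4n−1) + 1`. -/
theorem no_steiner_3_family (n : ℕ) (hn : 2 ≤ n)
    (V : Type*) [Fintype V] [DecidableEq V]
    (hV : Fintype.card V = (2 * n - 1) * (4 * n - 1) + 1) (D : Finset (Finset V))
    (hblocks : ∀ B ∈ D, B.card = 4 * n - 1)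
    (hdesign : ∀ T : Finset V, T.card = 3 →
      (D.filter (fun B => T ⊆ B)).card = 1) :
    False := by
  obtain ⟨m, rfl⟩ := Nat.exists_eq_add_of_le hn
  have h2 : 2 * (2 + m) - 1 = 2 * m + 3 := by omega
  have h4 : 4 * (2 + m) - 1 = 4 * m + 7 := by omega
  rw [h2, h4] at hV
  rw [h4] at hblocks
  obtain ⟨T, -, hT⟩ := Finset.exists_subset_card_eq (s := (Finset.univ : Finset V)) (n := 3)
    (by rw [Finset.card_univ, hV]; nlinarith)
  obtain ⟨B, hB⟩ := Finset.card_pos.1 ((hdesign T hT).symm ▸ Nat.one_pos)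
  have hBD := (Finset.mem_filter.1 hB).1
  have hcard := hblocks B hBD
  obtain ⟨p, hp⟩ := Finset.card_pos.1 (by omega : 0 < B.card)
  obtain ⟨x, -, hx⟩ := Finset.exists_mem_notMem_of_card_lt_card
    (s := B) (t := Finset.univ) (by rw [Finset.card_univ, hV, hcard]; nlinarith)
  have hbound := steiner_three_card_bound hblocks hdesign hBD hp hx
  have h1 : 4 * m + 7 - 1 = 4 * m + 6 := by omega
  have h5 : 4 * m + 7 - 2 = 4 * m + 5 := by omega
  rw [h1, h5, hV] at hbound
  have hle := hbound.trans (Nat.sub_le _ _)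
  nlinarith
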